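/- arXiv:1703.04076 — 3 statements merged into one kernel-verified Lean document; each statement's English description precedes it below -/
import Mathlib

section
/- Let x ∈ A be solvable and y ∈ A satisfy [x,y] = 1, and let (ρ,σ) be a pair of relatively prime positive integers such that v_{ρ,σ}(x) ≥ ρ + σ. Let f and g be the (ρ,σ)-polynomials of x and y respectively. Then there is a nonzero scalar c ∈ F such that g^{v_{ρ,σ}(x)} = c · f^{v_{ρ,σ}(y)}. (Lemma 3.4 combined with Dixmier's Lemma 3.2) -/
open scoped BigOperators

/-- Defining relation of the Weyl algebra: `p * q = q * p + 1`. -/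
inductive WeylRel (F : Type*) [CommRing F] :
    FreeAlgebra F (Fin 2) → FreeAlgebra F (Fin 2) → Prop
  | comm : WeylRel F (FreeAlgebra.ι F 0 * FreeAlgebra.ι F 1)
      (FreeAlgebra.ι F 1 * FreeAlgebra.ι F 0 + 1)

/-- The Weyl algebra over `F`. -/
abbrev WeylAlgebra (F : Type*) [CommRing F] := RingQuot (WeylRel F)

variable (F : Type*) [Field F] [CharZero F]

/-- The generator `p` of the Weyl algebra. -/
noncomputable def Wp : WeylAlgebra F :=
  RingQuot.mkAlgHom F (WeylRel F) (FreeAlgebra.ι F 0)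

/-- The generator `q` of the Weyl algebra. -/
noncomputable def Wq : WeylAlgebra F :=
  RingQuot.mkAlgHom F (WeylRel F) (FreeAlgebra.ι F 1)

/-- `x` is solvable if `[x, y] = 1` for some `y`. -/
def Solvable (x : WeylAlgebra F) : Prop := ∃ y : WeylAlgebra F, x * y - y * x = 1

/-- The centralizer `C(x)`. -/
def Cset (x : WeylAlgebra F) : Set (WeylAlgebra F) := {y | x * y - y * x = 0}

/-- `N(x) = {y | (ad x)^n y = 0 for some n ≥ 1}`. -/
def Nset (x : WeylAlgebra F) : Set (WeylAlgebra F) :=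
  {y | ∃ n : ℕ, 1 ≤ n ∧ (fun z => x * z - z * x)^[n] y = 0}

/-- `D(x) = {y | [x,y] = λ y for some scalar λ}`. -/
def Dset (x : WeylAlgebra F) : Set (WeylAlgebra F) :=
  {y | ∃ c : F, x * y - y * x = c • y}

def Delta1 : Set (WeylAlgebra F) :=
  {x | x ∉ Set.range (algebraMap F (WeylAlgebra F)) ∧
    Nset F x = Set.univ ∧ Dset F x = Cset F x}

def Delta2 : Set (WeylAlgebra F) :=
  {x | x ∉ Set.range (algebraMap F (WeylAlgebra F)) ∧
    Nset F x ≠ Set.univ ∧ Nset F x ≠ Cset F x ∧ Dset F x = Cset F x}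

/-- The graded component `A_s = {a | [pq, a] = s • a}`. -/
def Wgrade (s : ℤ) : Set (WeylAlgebra F) :=
  {a | (Wp F * Wq F) * a - a * (Wp F * Wq F) = s • a}

/-- The monomial `p^i q^j`. -/
noncomputable def Wmono (i j : ℕ) : WeylAlgebra F := Wp F ^ i * Wq F ^ j

/-- `α` is the coordinate family of `x` in the basis `p^i q^j`. -/
def Represents (α : (ℕ × ℕ) →₀ F) (x : WeylAlgebra F) : Prop :=
  x = α.sum fun ij c => c • Wmono F ij.1 ij.2

/-- `v_{ρ,σ}(x) = max { iρ + jσ | (i,j) ∈ E(x) }`. -/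
def vdeg (α : (ℕ × ℕ) →₀ F) (ρ σ : ℕ) : ℕ :=
  α.support.sup fun ij => ij.1 * ρ + ij.2 * σ

/-- `E_{ρ,σ}(x)`. -/
def Eset (α : (ℕ × ℕ) →₀ F) (ρ σ : ℕ) : Finset (ℕ × ℕ) :=
  α.support.filter fun ij => ij.1 * ρ + ij.2 * σ = vdeg F α ρ σ

/-- The `(ρ,σ)`-polynomial of `x`, an element of `F[X,Y]`. -/
noncomputable def wpoly (α : (ℕ × ℕ) →₀ F) (ρ σ : ℕ) : MvPolynomial (Fin 2) F :=
  ∑ ij ∈ Eset F α ρ σ,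
    MvPolynomial.monomial (Finsupp.single 0 ij.1 + Finsupp.single 1 ij.2) (α ij)

/-- The `(ρ,σ)`-term of `x`, an element of the Weyl algebra. -/
noncomputable def wterm (α : (ℕ × ℕ) →₀ F) (ρ σ : ℕ) : WeylAlgebra F :=
  ∑ ij ∈ Eset F α ρ σ, α ij • Wmono F ij.1 ij.2

namespace WeylSymbol

open MvPolynomial

section WeightFiltration

variable {R τ : Type*} [CommRing R] (w : τ → ℤ)

/-- The polynomials all of whose monomials have `w`-weight at most `n`. -/
def weightLE (n : ℤ) : Submodule R (MvPolynomial τ R) where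
  carrier := {a | ∀ m, n < Finsupp.weight w m → coeff m a = 0}
  add_mem' ha hb m hm := by rw [coeff_add, ha m hm, hb m hm, add_zero]
  zero_mem' _ _ := coeff_zero _
  smul_mem' c a ha m hm := by rw [coeff_smul, ha m hm, smul_zero]

variable {w} {a b : MvPolynomial τ R} {m n : ℤ}

theorem mem_weightLE : a ∈ weightLE w n ↔ ∀ d, n < Finsupp.weight w d → coeff d a = 0 :=
  Iff.rfl

theorem weightLE_mono (h : m ≤ n) (ha : a ∈ weightLE w m) : a ∈ weightLE w n :=
  fun d hd => ha d (h.trans_lt hd)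

theorem mul_mem_weightLE (ha : a ∈ weightLE w m) (hb : b ∈ weightLE w n) :
    a * b ∈ weightLE w (m + n) := by
  classical
  intro d hd
  rw [coeff_mul]
  refine Finset.sum_eq_zero fun e he => ?_
  rw [← Finset.HasAntidiagonal.mem_antidiagonal.mp he, map_add] at hd
  rcases lt_or_ge m (Finsupp.weight w e.1) with h | h
  · rw [ha _ h, zero_mul]
  · rw [hb _ (by linarith), mul_zero]

theorem pderiv_mem_weightLE (i : τ) (ha : a ∈ weightLE w n) :
    pderiv i a ∈ weightLE w (n - w i) := by
  intro d hd
  rw [coeff_pderiv, ha, zero_mul]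
  rw [map_add, Finsupp.weight_single, one_smul]
  linarith

theorem monomial_mem_weightLE (d : τ →₀ ℕ) (r : R) (h : Finsupp.weight w d ≤ n) :
    monomial d r ∈ weightLE w n := by
  classical
  intro e he
  rw [coeff_monomial, if_neg]
  rintro rfl
  exact he.not_ge h

theorem one_mem_weightLE (h : 0 ≤ n) : (1 : MvPolynomial τ R) ∈ weightLE w n :=
  monomial_mem_weightLE 0 1 (by simpa using h)

theorem X_mem_weightLE (i : τ) : (X i : MvPolynomial τ R) ∈ weightLE w (w i) :=
  monomial_mem_weightLE _ 1 (by simp [Finsupp.weight_single])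

theorem X_pow_mem_weightLE (i : τ) (k : ℕ) :
    (X i ^ k : MvPolynomial τ R) ∈ weightLE w (k * w i) := by
  rw [X_pow_eq_monomial]
  exact monomial_mem_weightLE _ 1 (by simp [Finsupp.weight_single])

theorem mem_weightLE_of_isWeightedHomogeneous (ha : IsWeightedHomogeneous w a n) :
    a ∈ weightLE w n := by
  intro d hd
  by_contra h
  exact hd.ne' (ha h)

theorem eq_zero_of_isWeightedHomogeneous_of_mem (ha : IsWeightedHomogeneous w a n)
    (hmem : a ∈ weightLE w m) (h : m < n) : a = 0 := by
  ext d
  rw [coeff_zero]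
  by_contra hd
  exact hd (hmem d (by rwa [ha hd]))

theorem isWeightedHomogeneous_natCast {w : τ → ℕ} {n : ℕ} (ha : IsWeightedHomogeneous w a n) :
    IsWeightedHomogeneous (fun i => (w i : ℤ)) a n := by
  intro d hd
  rw [← ha hd, Finsupp.weight_apply, Finsupp.weight_apply, Finsupp.sum, Finsupp.sum]
  push_cast
  simp

end WeightFiltration

section PoissonBracket

variable {R : Type*} [CommRing R]

/-- The Poisson bracket of two polynomials in two variables. -/
noncomputable def poisson (a b : MvPolynomial (Fin 2) R) : MvPolynomial (Fin 2) R :=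
  pderiv 0 a * pderiv 1 b - pderiv 1 a * pderiv 0 b

variable {a b : MvPolynomial (Fin 2) R} {m n : ℤ}

theorem poisson_mem_weightLE {w : Fin 2 → ℤ} (ha : a ∈ weightLE w m) (hb : b ∈ weightLE w n) :
    poisson a b ∈ weightLE w (m + n - (w 0 + w 1)) := by
  refine sub_mem (weightLE_mono ?_ (mul_mem_weightLE (pderiv_mem_weightLE 0 ha)
    (pderiv_mem_weightLE 1 hb))) (weightLE_mono ?_ (mul_mem_weightLE (pderiv_mem_weightLE 1 ha)
    (pderiv_mem_weightLE 0 hb))) <;> linarith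

theorem isWeightedHomogeneous_poisson {w : Fin 2 → ℤ} (ha : IsWeightedHomogeneous w a m)
    (hb : IsWeightedHomogeneous w b n) :
    IsWeightedHomogeneous w (poisson a b) (m + n - (w 0 + w 1)) := by
  have key (i j : Fin 2) (h : w i + w j = w 0 + w 1) :
      IsWeightedHomogeneous w (pderiv i a * pderiv j b) (m + n - (w 0 + w 1)) := by
    have := (ha.pderiv (i := i) (sub_add_cancel m (w i))).mul
      (hb.pderiv (i := j) (sub_add_cancel n (w j)))
    rwa [show m - w i + (n - w j) = m + n - (w 0 + w 1) by rw [← h]; ring] at this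
  exact (weightedHomogeneousSubmodule R w _).sub_mem (key 0 1 rfl) (key 1 0 (add_comm _ _))

/-- If two weighted homogeneous polynomials Poisson-commute, Euler's identity yields
a proportionality between their logarithmic derivatives. -/
theorem mul_pderiv_eq_of_poisson_eq_zero {w : Fin 2 → ℕ} {m n : ℕ}
    (ha : IsWeightedHomogeneous w a m) (hb : IsWeightedHomogeneous w b n)
    (h : poisson a b = 0) :
    (m : MvPolynomial (Fin 2) R) * a * pderiv 0 b = n * b * pderiv 0 a := by
  have ea := ha.sum_weight_X_mul_pderiv
  have eb := hb.sum_weight_X_mul_pderiv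
  simp only [Fin.sum_univ_two, nsmul_eq_mul] at ea eb
  unfold poisson at h
  linear_combination (-pderiv 0 b) * ea + pderiv 0 a * eb - (w 1 : MvPolynomial (Fin 2) R) * X 1 * h

end PoissonBracket

section Dehomogenize

variable {K : Type*} [Field K]

variable (K) in
/-- Setting the second variable to `1`. -/
noncomputable def dehomogenize : MvPolynomial (Fin 2) K →ₐ[K] Polynomial K :=
  aeval ![Polynomial.X, 1]

theorem derivative_dehomogenize (a : MvPolynomial (Fin 2) K) :
    Polynomial.derivative (dehomogenize K a) = dehomogenize K (pderiv 0 a) := by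
  induction a using MvPolynomial.induction_on with
  | C r => simp [dehomogenize]
  | add p q hp hq => simp [hp, hq]
  | mul_X p i hp =>
    simp only [map_mul, Polynomial.derivative_mul, hp, pderiv_mul, map_add]
    congr 1
    fin_cases i <;> simp [dehomogenize, pderiv_X]

theorem coeff_dehomogenize {w : Fin 2 → ℕ} (hw : w 1 ≠ 0) {n : ℕ}
    {a : MvPolynomial (Fin 2) K} (ha : IsWeightedHomogeneous w a n) {d : Fin 2 →₀ ℕ}
    (hd : d ∈ a.support) : (dehomogenize K a).coeff (d 0) = coeff d a := by
  rw [dehomogenize, aeval_def, eval₂_eq', Polynomial.finsetSum_coeff]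
  rw [Finset.sum_eq_single_of_mem d hd]
  · simp [Fin.prod_univ_two, Polynomial.algebraMap_eq]
  · intro e he hne
    simp only [Fin.prod_univ_two, Matrix.cons_val_zero, Matrix.cons_val_one, one_pow, mul_one,
      Polynomial.algebraMap_eq, Polynomial.coeff_C_mul, Polynomial.coeff_X_pow]
    rw [if_neg, mul_zero]
    intro h0
    refine hne (Finsupp.ext fun i => ?_)
    have h1 := (ha (mem_support_iff.mp hd)).trans (ha (mem_support_iff.mp he)).symm
    rw [Finsupp.weight_apply, Finsupp.weight_apply, Finsupp.sum_fintype _ _ (by simp),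
      Finsupp.sum_fintype _ _ (by simp)] at h1
    simp only [Fin.sum_univ_two, smul_eq_mul, h0] at h1
    have h2 : d 1 = e 1 := Nat.eq_of_mul_eq_mul_right (Nat.pos_of_ne_zero hw) (by omega)
    fin_cases i
    · exact h0.symm
    · exact h2.symm

theorem eq_zero_of_dehomogenize_eq_zero {w : Fin 2 → ℕ} (hw : w 1 ≠ 0) {n : ℕ}
    {a : MvPolynomial (Fin 2) K} (ha : IsWeightedHomogeneous w a n)
    (h : dehomogenize K a = 0) : a = 0 := by
  rw [← support_eq_empty, Finset.eq_empty_iff_forall_notMem]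
  intro d hd
  have := coeff_dehomogenize hw ha hd
  rw [h, Polynomial.coeff_zero] at this
  exact mem_support_iff.mp hd this.symm

end Dehomogenize

section Wronskian

variable {K : Type*} [Field K] [CharZero K]

theorem natDegree_eq_of_wronskian_eq_zero {P Q : Polynomial K} (hP : P ≠ 0) (hQ : Q ≠ 0)
    (h : P.wronskian Q = 0) : P.natDegree = Q.natDegree := by
  have hc := congrArg (Polynomial.coeff · (P.natDegree + Q.natDegree - 1)) h
  have key (A B : Polynomial K) :
      (A * Polynomial.derivative B).coeff (A.natDegree + B.natDegree - 1) =
        A.leadingCoeff * B.leadingCoeff * B.natDegree := by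
    rcases Nat.eq_zero_or_pos B.natDegree with h0 | h0
    · rw [Polynomial.derivative_of_natDegree_zero h0, h0]; simp
    · rw [Nat.add_sub_assoc h0, Polynomial.coeff_mul_add_eq_of_natDegree_le le_rfl
        (Polynomial.natDegree_derivative_le B), Polynomial.coeff_derivative,
        Nat.sub_add_cancel h0, Nat.cast_sub h0]
      simp only [Polynomial.coeff_natDegree]
      push_cast
      ring
  simp only [Polynomial.wronskian, Polynomial.coeff_sub, Polynomial.coeff_zero,
    mul_comm (Polynomial.derivative P)] at hc
  rw [key, add_comm P.natDegree, key] at hc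
  have h2 : P.leadingCoeff * Q.leadingCoeff * ((Q.natDegree : K) - P.natDegree) = 0 := by
    linear_combination hc
  have h3 := (mul_eq_zero.mp h2).resolve_left
    (mul_ne_zero (Polynomial.leadingCoeff_ne_zero.mpr hP) (Polynomial.leadingCoeff_ne_zero.mpr hQ))
  exact_mod_cast (sub_eq_zero.mp h3).symm

theorem exists_eq_smul_of_wronskian_eq_zero {P Q : Polynomial K} (hQ : Q ≠ 0)
    (h : P.wronskian Q = 0) : ∃ c : K, P = c • Q := by
  refine ⟨P.coeff Q.natDegree / Q.leadingCoeff, ?_⟩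
  set c := P.coeff Q.natDegree / Q.leadingCoeff with hc
  rw [← sub_eq_zero]
  by_contra hR
  have hw : (P - c • Q).wronskian Q = 0 := by
    rw [sub_eq_add_neg, Polynomial.wronskian_add_left, h, Polynomial.wronskian_neg_left,
      ← Polynomial.wronskianBilin_apply, map_smul, LinearMap.smul_apply,
      Polynomial.wronskianBilin_apply, Polynomial.wronskian_self_eq_zero]
    simp
  have hd := natDegree_eq_of_wronskian_eq_zero hR hQ hw
  refine hR (Polynomial.leadingCoeff_eq_zero.mp ?_)
  rw [Polynomial.leadingCoeff, hd, Polynomial.coeff_sub, Polynomial.coeff_smul, smul_eq_mul, hc,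
    Polynomial.coeff_natDegree, div_mul_cancel₀ _ (Polynomial.leadingCoeff_ne_zero.mpr hQ),
    sub_self]

/-- Poisson-commuting nonzero weighted homogeneous polynomials of positive weights
have proportional powers. -/
theorem exists_pow_eq_smul_pow {w : Fin 2 → ℕ} (hw : w 1 ≠ 0) {m n : ℕ} (hm : m ≠ 0) (hn : n ≠ 0)
    {f g : MvPolynomial (Fin 2) K} (hf : IsWeightedHomogeneous w f m)
    (hg : IsWeightedHomogeneous w g n) (hf0 : f ≠ 0) (hg0 : g ≠ 0) (h : poisson f g = 0) :
    ∃ c : K, c ≠ 0 ∧ g ^ m = c • f ^ n := by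
  have hQ : dehomogenize K (f ^ n) ≠ 0 := by
    rw [map_pow]
    exact pow_ne_zero _ fun h0 => hf0 (eq_zero_of_dehomogenize_eq_zero hw hf h0)
  have hW : (dehomogenize K (g ^ m)).wronskian (dehomogenize K (f ^ n)) = 0 := by
    have key := congrArg (dehomogenize K) (mul_pderiv_eq_of_poisson_eq_zero hf hg h)
    rw [Polynomial.wronskian, derivative_dehomogenize, derivative_dehomogenize, pderiv_pow,
      pderiv_pow]
    obtain ⟨m, rfl⟩ := Nat.exists_eq_succ_of_ne_zero hm
    obtain ⟨n, rfl⟩ := Nat.exists_eq_succ_of_ne_zero hn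
    simp only [map_mul, map_pow, map_natCast, Nat.succ_eq_add_one, Nat.add_sub_cancel] at key ⊢
    linear_combination -(dehomogenize K g ^ m * dehomogenize K f ^ n) * key
  obtain ⟨c, hc⟩ := exists_eq_smul_of_wronskian_eq_zero hQ hW
  have heq : g ^ m = c • f ^ n := by
    rw [← sub_eq_zero]
    refine eq_zero_of_dehomogenize_eq_zero hw (n := m * n)
      ((weightedHomogeneousSubmodule K w _).sub_mem (hg.pow m)
        ((weightedHomogeneousSubmodule K w _).smul_mem c ?_)) ?_
    · have := hf.pow n
      rwa [smul_eq_mul, mul_comm] at this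
    · rw [map_sub, map_smul, hc, sub_self]
  refine ⟨c, ?_, heq⟩
  rintro rfl
  exact pow_ne_zero m hg0 (by rw [heq, zero_smul])

end Wronskian

section Action

variable {K : Type*} [Field K]

variable (K) in
/-- The action of `q` on normally ordered symbols. -/
noncomputable def qAction : Module.End K (MvPolynomial (Fin 2) K) :=
  LinearMap.mulLeft K (X 1) - (pderiv (R := K) (0 : Fin 2)).toLinearMap

theorem qAction_apply (b : MvPolynomial (Fin 2) K) : qAction K b = X 1 * b - pderiv 0 b := rfl

variable (K) in
/-- The regular representation of the Weyl algebra, written on normally ordered symbols. -/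
noncomputable def action : WeylAlgebra K →ₐ[K] Module.End K (MvPolynomial (Fin 2) K) :=
  RingQuot.liftAlgHom K ⟨FreeAlgebra.lift K ![LinearMap.mulLeft K (X 0), qAction K], by
    rintro _ _ ⟨⟩
    refine LinearMap.ext fun b => ?_
    simp [qAction_apply]
    ring⟩

theorem action_Wp (b : MvPolynomial (Fin 2) K) : action K (Wp K) b = X 0 * b := by
  rw [action, Wp, RingQuot.liftAlgHom_mkAlgHom_apply]
  simp

theorem action_Wq : action K (Wq K) = qAction K := by
  rw [action, Wq, RingQuot.liftAlgHom_mkAlgHom_apply]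
  simp

theorem action_Wmono (i j : ℕ) (b : MvPolynomial (Fin 2) K) :
    action K (Wmono K i j) b = X 0 ^ i * (qAction K ^ j) b := by
  rw [Wmono, map_mul, map_pow, map_pow, action_Wq, Module.End.mul_apply]
  induction i with
  | zero => simp
  | succ i ih => rw [pow_succ', Module.End.mul_apply, ih, action_Wp]; ring

theorem qAction_pow_sub_mem {w : Fin 2 → ℤ} (hw : 0 ≤ w 0 + w 1) {n : ℤ} {b : MvPolynomial (Fin 2) K}
    (hb : b ∈ weightLE w n) (j : ℕ) :
    (qAction K ^ j) b - (X 1 ^ j * b - pderiv 1 (X 1 ^ j) * pderiv 0 b) ∈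
      weightLE w (j * w 1 + n - 2 * (w 0 + w 1)) := by
  induction j with
  | zero => simp
  | succ j ih =>
    set e := (qAction K ^ j) b - (X 1 ^ j * b - pderiv 1 (X 1 ^ j) * pderiv 0 b) with he
    have h0 : pderiv (0 : Fin 2) (X 1 ^ j : MvPolynomial (Fin 2) K) = 0 := by
      simp [pderiv_X]
    have h1 : pderiv (0 : Fin 2) (pderiv 1 (X 1 ^ j : MvPolynomial (Fin 2) K)) = 0 := by
      simp [pderiv_X]
    have heq : (qAction K ^ (j + 1)) b
          - (X 1 ^ (j + 1) * b - pderiv 1 (X 1 ^ (j + 1)) * pderiv 0 b) =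
        X 1 * e - pderiv 0 e + pderiv 1 (X 1 ^ j) * pderiv 0 (pderiv 0 b) := by
      rw [pow_succ' (qAction K), Module.End.mul_apply,
        show (qAction K ^ j) b = e + (X 1 ^ j * b - pderiv 1 (X 1 ^ j) * pderiv 0 b) by
          rw [he]; ring, pow_succ' (X 1), pderiv_mul, qAction_apply]
      simp only [map_add, map_sub, pderiv_mul, h0, h1, pderiv_X_self]
      ring
    rw [heq]
    refine add_mem (sub_mem (weightLE_mono ?_ (mul_mem_weightLE (X_mem_weightLE 1) ih))
      (weightLE_mono ?_ (pderiv_mem_weightLE 0 ih))) (weightLE_mono ?_ (mul_mem_weightLE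
        (pderiv_mem_weightLE 1 (X_pow_mem_weightLE 1 j))
        (pderiv_mem_weightLE 0 (pderiv_mem_weightLE 0 hb))))
    all_goals push_cast
    all_goals linarith

/-- The normally ordered symbol with coordinate family `α`. -/
noncomputable def symbol (α : (ℕ × ℕ) →₀ K) : MvPolynomial (Fin 2) K :=
  α.sum fun ij c => c • (X 0 ^ ij.1 * X 1 ^ ij.2)

theorem action_one {x : WeylAlgebra K} {α : (ℕ × ℕ) →₀ K} (hx : Represents K α x) :
    action K x 1 = symbol α := by
  have h1 (j : ℕ) : (qAction K ^ j) 1 = X 1 ^ j := by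
    induction j with
    | zero => simp
    | succ j ih =>
      rw [pow_succ', Module.End.mul_apply, ih, qAction_apply]
      simp [pderiv_X, pow_succ']
  rw [hx, symbol, Finsupp.sum, Finsupp.sum, map_sum, LinearMap.sum_apply]
  refine Finset.sum_congr rfl fun ij _ => ?_
  rw [map_smul, LinearMap.smul_apply, action_Wmono, h1]

theorem symbol_mem_weightLE {w : Fin 2 → ℤ} {m : ℤ} {α : (ℕ × ℕ) →₀ K}
    (hα : ∀ ij ∈ α.support, ij.1 * w 0 + ij.2 * w 1 ≤ m) : symbol α ∈ weightLE w m :=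
  sum_mem fun ij hij => Submodule.smul_mem _ _ (weightLE_mono (hα ij hij)
    (mul_mem_weightLE (X_pow_mem_weightLE 0 ij.1) (X_pow_mem_weightLE 1 ij.2)))

theorem action_apply_sub_mem {w : Fin 2 → ℤ} (hw : 0 ≤ w 0 + w 1) {m n : ℤ}
    {x : WeylAlgebra K} {α : (ℕ × ℕ) →₀ K}
    (hx : Represents K α x) (hα : ∀ ij ∈ α.support, ij.1 * w 0 + ij.2 * w 1 ≤ m)
    {b : MvPolynomial (Fin 2) K} (hb : b ∈ weightLE w n) :
    action K x b - (symbol α * b - pderiv 1 (symbol α) * pderiv 0 b) ∈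
      weightLE w (m + n - 2 * (w 0 + w 1)) := by
  have heq : action K x b - (symbol α * b - pderiv 1 (symbol α) * pderiv 0 b) =
      ∑ ij ∈ α.support, α ij • (X 0 ^ ij.1 * ((qAction K ^ ij.2) b -
        (X 1 ^ ij.2 * b - pderiv 1 (X 1 ^ ij.2) * pderiv 0 b))) := by
    rw [hx, symbol, Finsupp.sum, Finsupp.sum, map_sum, LinearMap.sum_apply, map_sum,
      Finset.sum_mul, Finset.sum_mul, ← Finset.sum_sub_distrib, ← Finset.sum_sub_distrib]
    refine Finset.sum_congr rfl fun ij _ => ?_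
    have h0 : pderiv (1 : Fin 2) (X 0 ^ ij.1 : MvPolynomial (Fin 2) K) = 0 := by
      simp [pderiv_X]
    rw [map_smul, LinearMap.smul_apply, action_Wmono, Derivation.map_smul, pderiv_mul, h0]
    simp only [smul_eq_C_mul]
    ring
  rw [heq]
  refine sum_mem fun ij hij => Submodule.smul_mem _ _ (weightLE_mono ?_
    (mul_mem_weightLE (X_pow_mem_weightLE 0 ij.1) (qAction_pow_sub_mem hw hb ij.2)))
  linarith [hα ij hij]

/-- The symbol of a commutator is the Poisson bracket of the symbols up to lower order. -/
theorem action_commutator_sub_mem {w : Fin 2 → ℤ} (hw : 0 ≤ w 0 + w 1) {m n : ℤ} {x y : WeylAlgebra K}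
    {α β : (ℕ × ℕ) →₀ K} (hx : Represents K α x) (hy : Represents K β y)
    (hα : ∀ ij ∈ α.support, ij.1 * w 0 + ij.2 * w 1 ≤ m)
    (hβ : ∀ ij ∈ β.support, ij.1 * w 0 + ij.2 * w 1 ≤ n) :
    action K (x * y - y * x) 1 - poisson (symbol α) (symbol β) ∈
      weightLE w (m + n - 2 * (w 0 + w 1)) := by
  have h1 := action_apply_sub_mem hw hx hα (symbol_mem_weightLE hβ)
  have h2 := action_apply_sub_mem hw hy hβ (symbol_mem_weightLE hα)
  rw [add_comm n m] at h2
  convert sub_mem h1 h2 using 1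
  rw [map_sub, map_mul, map_mul, LinearMap.sub_apply, Module.End.mul_apply, Module.End.mul_apply,
    action_one hx, action_one hy, poisson]
  ring

end Action

section LeadingForm

variable {K : Type*} [Field K]

theorem le_vdeg (α : (ℕ × ℕ) →₀ K) (ρ σ : ℕ) {ij : ℕ × ℕ} (h : ij ∈ α.support) :
    ij.1 * ρ + ij.2 * σ ≤ vdeg K α ρ σ :=
  Finset.le_sup (f := fun ij : ℕ × ℕ => ij.1 * ρ + ij.2 * σ) h

theorem isWeightedHomogeneous_wpoly (α : (ℕ × ℕ) →₀ K) (ρ σ : ℕ) :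
    IsWeightedHomogeneous ![ρ, σ] (wpoly K α ρ σ) (vdeg K α ρ σ) := by
  refine IsWeightedHomogeneous.sum _ _ _ fun ij hij => isWeightedHomogeneous_monomial _ _ _ ?_
  rw [← (Finset.mem_filter.mp hij).2]
  simp [Finsupp.weight_single]

theorem symbol_sub_wpoly_mem_weightLE (α : (ℕ × ℕ) →₀ K) (ρ σ : ℕ) :
    symbol α - wpoly K α ρ σ ∈
      weightLE (fun i => ((![ρ, σ] : Fin 2 → ℕ) i : ℤ)) (vdeg K α ρ σ - 1) := by
  have heq : symbol α - wpoly K α ρ σ =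
      ∑ ij ∈ α.support with ¬ ij.1 * ρ + ij.2 * σ = vdeg K α ρ σ,
        α ij • (X 0 ^ ij.1 * X 1 ^ ij.2) := by
    rw [sub_eq_iff_eq_add', symbol, Finsupp.sum, wpoly, Eset,
      ← Finset.sum_filter_add_sum_filter_not α.support
        (fun ij => ij.1 * ρ + ij.2 * σ = vdeg K α ρ σ)]
    congr 1
    refine Finset.sum_congr rfl fun ij _ => ?_
    rw [X_pow_eq_monomial, X_pow_eq_monomial, monomial_mul, smul_monomial]
    simp
  rw [heq]
  refine sum_mem fun ij hij => Submodule.smul_mem _ _ (weightLE_mono ?_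
    (mul_mem_weightLE (X_pow_mem_weightLE 0 ij.1) (X_pow_mem_weightLE 1 ij.2)))
  obtain ⟨hij, hne⟩ := Finset.mem_filter.mp hij
  have := (le_vdeg α ρ σ hij).lt_of_ne hne
  simp only [Matrix.cons_val_zero, Matrix.cons_val_one]
  have h : ((ij.1 * ρ + ij.2 * σ : ℕ) : ℤ) < vdeg K α ρ σ := by exact_mod_cast this
  push_cast at h
  linarith

theorem wpoly_ne_zero {α : (ℕ × ℕ) →₀ K} {ρ σ : ℕ} (h : α ≠ 0) : wpoly K α ρ σ ≠ 0 := by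
  classical
  obtain ⟨ij, hij, hv⟩ := Finset.exists_mem_eq_sup α.support (Finsupp.support_nonempty_iff.mpr h)
    fun ij => ij.1 * ρ + ij.2 * σ
  intro h0
  have hc := congrArg (coeff (Finsupp.single 0 ij.1 + Finsupp.single 1 ij.2)) h0
  rw [wpoly, Eset, coeff_sum, Finset.sum_eq_single_of_mem ij (Finset.mem_filter.mpr ⟨hij, hv.symm⟩),
    coeff_monomial, if_pos rfl, coeff_zero] at hc
  · exact Finsupp.mem_support_iff.mp hij hc
  · intro kl _ hne
    rw [coeff_monomial, if_neg]
    intro he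
    refine hne (Prod.ext ?_ ?_)
    · simpa using DFunLike.congr_fun he 0
    · simpa using DFunLike.congr_fun he 1

theorem eq_algebraMap_of_vdeg_eq_zero {x : WeylAlgebra K} {α : (ℕ × ℕ) →₀ K}
    (hx : Represents K α x) {ρ σ : ℕ} (hρ : 0 < ρ) (hσ : 0 < σ) (h : vdeg K α ρ σ = 0) :
    x = algebraMap K _ (α (0, 0)) := by
  rw [hx, Finsupp.sum, Finset.sum_eq_single (0, 0)]
  · simp [Wmono, Algebra.algebraMap_eq_smul_one]
  · intro ij hij hne
    have := le_vdeg α ρ σ hij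
    rw [h, Nat.le_zero, Nat.add_eq_zero_iff, mul_eq_zero, mul_eq_zero] at this
    exact absurd (Prod.ext (this.1.resolve_right hρ.ne') (this.2.resolve_right hσ.ne')) hne
  · intro hn
    rw [Finsupp.notMem_support_iff.mp hn, zero_smul]

theorem vdeg_ne_zero_of_commutator_eq_one {x y : WeylAlgebra K} {β : (ℕ × ℕ) →₀ K}
    (hy : Represents K β y) (hxy : x * y - y * x = 1) {ρ σ : ℕ} (hρ : 0 < ρ) (hσ : 0 < σ) :
    vdeg K β ρ σ ≠ 0 := by
  intro h
  rw [eq_algebraMap_of_vdeg_eq_zero hy hρ hσ h, Algebra.commutes, sub_self] at hxy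
  have := congrArg (fun z => action K z 1) hxy
  simp at this

theorem poisson_wpoly_eq_zero {x y : WeylAlgebra K} {α β : (ℕ × ℕ) →₀ K}
    (hx : Represents K α x) (hy : Represents K β y) (hxy : x * y - y * x = 1) {ρ σ : ℕ}
    (hρ : 0 < ρ) (hσ : 0 < σ) (hv : ρ + σ < vdeg K α ρ σ + vdeg K β ρ σ) :
    poisson (wpoly K α ρ σ) (wpoly K β ρ σ) = 0 := by
  set w : Fin 2 → ℤ := fun i => ((![ρ, σ] : Fin 2 → ℕ) i : ℤ) with hw
  have hw0 : w 0 = ρ := rfl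
  have hw1 : w 1 = σ := rfl
  have bound (γ : (ℕ × ℕ) →₀ K) : ∀ ij ∈ γ.support,
      ij.1 * w 0 + ij.2 * w 1 ≤ (vdeg K γ ρ σ : ℤ) := by
    intro ij hij
    rw [hw0, hw1]
    exact_mod_cast le_vdeg γ ρ σ hij
  have hα := isWeightedHomogeneous_natCast (isWeightedHomogeneous_wpoly α ρ σ)
  have hβ := isWeightedHomogeneous_natCast (isWeightedHomogeneous_wpoly β ρ σ)
  refine eq_zero_of_isWeightedHomogeneous_of_mem (isWeightedHomogeneous_poisson hα hβ)
    (m := vdeg K α ρ σ + vdeg K β ρ σ - (w 0 + w 1) - 1) ?_ (sub_one_lt _)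
  have h1 := action_commutator_sub_mem (by omega) hx hy (bound α) (bound β)
  rw [hxy, map_one (action K), Module.End.one_apply] at h1
  have h2 := poisson_mem_weightLE (symbol_sub_wpoly_mem_weightLE α ρ σ)
    (symbol_mem_weightLE (bound β))
  have h3 := poisson_mem_weightLE (mem_weightLE_of_isWeightedHomogeneous hα)
    (symbol_sub_wpoly_mem_weightLE β ρ σ)
  have heq : poisson (wpoly K α ρ σ) (wpoly K β ρ σ) =
      1 - (1 - poisson (symbol α) (symbol β)) - poisson (symbol α - wpoly K α ρ σ) (symbol β)
        - poisson (wpoly K α ρ σ) (symbol β - wpoly K β ρ σ) := by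
    simp only [poisson, map_sub]
    ring
  rw [heq]
  refine sub_mem (sub_mem (sub_mem (one_mem_weightLE ?_) (weightLE_mono ?_ h1))
    (weightLE_mono ?_ h2)) (weightLE_mono ?_ h3)
  all_goals simp only [hw0, hw1, Matrix.cons_val_zero, Matrix.cons_val_one]
  all_goals omega

end LeadingForm

end WeylSymbol

/-- Lemma 3.4 combined with Dixmier's Lemma 3.2. -/
theorem wpoly_pow_eq_of_solvable (x y : WeylAlgebra F) (α β : (ℕ × ℕ) →₀ F)
    (hx : Represents F α x) (hy : Represents F β y)
    (hxy : x * y - y * x = 1)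
    (ρ σ : ℕ) (hρ : 0 < ρ) (hσ : 0 < σ) (hco : Nat.Coprime ρ σ)
    (hv : ρ + σ ≤ vdeg F α ρ σ) :
    ∃ c : F, c ≠ 0 ∧
      wpoly F β ρ σ ^ vdeg F α ρ σ = c • wpoly F α ρ σ ^ vdeg F β ρ σ := by
  have hw := WeylSymbol.vdeg_ne_zero_of_commutator_eq_one hy hxy hρ hσ
  have hα : α ≠ 0 := by
    rintro rfl
    simp [vdeg] at hv
    omega
  have hβ : β ≠ 0 := by
    rintro rfl
    exact hw rfl
  exact WeylSymbol.exists_pow_eq_smul_pow (w := ![ρ, σ]) hσ.ne' (by omega) hw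
    (WeylSymbol.isWeightedHomogeneous_wpoly α ρ σ) (WeylSymbol.isWeightedHomogeneous_wpoly β ρ σ)
    (WeylSymbol.wpoly_ne_zero hα) (WeylSymbol.wpoly_ne_zero hβ)
    (WeylSymbol.poisson_wpoly_eq_zero hx hy hxy hρ hσ (by omega))
end

section
/- Let x ∈ Δ1 be a solvable element of A, and let y ∈ A be an element such that [x, y] = 1. Then y ∈ Δ1. (Lemma 3.6) -/
open scoped BigOperators

variable (F : Type*) [Field F] [CharZero F]

open MvPolynomial
open scoped MonomialOrder

section Commutator

variable {R : Type*} [Ring R] {x y : R}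

theorem bracket_pow_of_bracket_eq_one (h : x * y - y * x = 1) (k : ℕ) :
    x * y ^ k - y ^ k * x = k * y ^ (k - 1) := by
  induction k with
  | zero => simp
  | succ k ih =>
    have hk : (k : R) * y ^ (k - 1) * y = k * y ^ k := by
      cases k with
      | zero => simp
      | succ k => simp [pow_succ, mul_assoc]
    calc x * y ^ (k + 1) - y ^ (k + 1) * x
        = (x * y ^ k - y ^ k * x) * y + y ^ k * (x * y - y * x) := by
          rw [pow_succ]; noncomm_ring
      _ = ((k + 1 : ℕ) : R) * y ^ (k + 1 - 1) := by
          rw [ih, h, hk]; push_cast; simp [add_mul]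

theorem pow_bracket_of_bracket_eq_one (h : x * y - y * x = 1) (k : ℕ) :
    x ^ k * y - y * x ^ k = k * x ^ (k - 1) := by
  rw [← bracket_pow_of_bracket_eq_one (x := -y) (y := x) (by rw [← h]; noncomm_ring)]
  noncomm_ring

end Commutator

variable (K : Type*) [Field K]

/-- Polynomials all of whose monomials have total degree at most the integer `k`. -/
def degreeLE (k : ℤ) : Submodule K (MvPolynomial (Fin 2) K) where
  carrier := {f | ∀ u, f.coeff u ≠ 0 → (u.degree : ℤ) ≤ k}
  zero_mem' u hu := by simp at hu
  add_mem' {f g} hf hg u hu := by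
    by_cases h : f.coeff u = 0
    · exact hg u fun h' => hu (by simp [h, h'])
    · exact hf u h
  smul_mem' c f hf u hu := hf u fun h => hu (by simp [h])

section DegreeLE

variable {K}
variable {f g : MvPolynomial (Fin 2) K} {k l : ℤ}

theorem degreeLE_mono (h : k ≤ l) (hf : f ∈ degreeLE K k) : f ∈ degreeLE K l :=
  fun u hu => (hf u hu).trans h

theorem mul_mem_degreeLE (hf : f ∈ degreeLE K k) (hg : g ∈ degreeLE K l) :
    f * g ∈ degreeLE K (k + l) := by
  intro u hu
  rw [coeff_mul] at hu
  obtain ⟨⟨a, b⟩, hab, h⟩ := Finset.exists_ne_zero_of_sum_ne_zero hu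
  have ha := hf a (left_ne_zero_of_mul h)
  have hb := hg b (right_ne_zero_of_mul h)
  rw [← Finset.HasAntidiagonal.mem_antidiagonal.1 hab, map_add]
  push_cast
  linarith

theorem pderiv_mem_degreeLE (i : Fin 2) (hf : f ∈ degreeLE K k) :
    pderiv i f ∈ degreeLE K (k - 1) := by
  intro u hu
  rw [coeff_pderiv] at hu
  have := hf _ (left_ne_zero_of_mul hu)
  rw [map_add, Finsupp.degree_single] at this
  push_cast at this
  linarith

theorem X_mem_degreeLE (i : Fin 2) : (X i : MvPolynomial (Fin 2) K) ∈ degreeLE K 1 := by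
  intro u hu
  rw [coeff_X] at hu
  split_ifs at hu with h
  · simp [← h]
  · simp at hu

theorem X_pow_mem_degreeLE (i : Fin 2) (n : ℕ) :
    (X i ^ n : MvPolynomial (Fin 2) K) ∈ degreeLE K n := by
  intro u hu
  rw [coeff_X_pow] at hu
  split_ifs at hu with h
  · simp [← h]
  · simp at hu

theorem mem_degreeLE_totalDegree (f : MvPolynomial (Fin 2) K) :
    f ∈ degreeLE K f.totalDegree := fun u hu => by
  exact_mod_cast le_totalDegree (mem_support_iff.2 hu)

theorem totalDegree_le_of_mem_degreeLE (hf : f ∈ degreeLE K k) (h0 : f ≠ 0) :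
    (f.totalDegree : ℤ) ≤ k := by
  rw [← degree_degLexDegree]
  exact hf _ (by simpa using h0)

end DegreeLE

/-- The operator `f ↦ X₁ f + ∂f/∂X₀` representing left multiplication by `p`. -/
noncomputable def pOperator : Module.End K (MvPolynomial (Fin 2) K) :=
  LinearMap.mulLeft K (X 1) + (pderiv 0).toLinearMap

/-- The operator `f ↦ X₀ f` representing left multiplication by `q`. -/
noncomputable def qOperator : Module.End K (MvPolynomial (Fin 2) K) :=
  LinearMap.mulLeft K (X 0)

@[simp]
theorem pOperator_apply (f : MvPolynomial (Fin 2) K) :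
    pOperator K f = X 1 * f + pderiv 0 f := rfl

@[simp]
theorem qOperator_apply (f : MvPolynomial (Fin 2) K) : qOperator K f = X 0 * f := rfl

/-- The left regular representation of the Weyl algebra, transported to polynomials by reading
`X₀ ^ i * X₁ ^ j` as `q ^ i * p ^ j`. -/
noncomputable def weylAction : WeylAlgebra K →ₐ[K] Module.End K (MvPolynomial (Fin 2) K) :=
  RingQuot.liftAlgHom K ⟨FreeAlgebra.lift K ![pOperator K, qOperator K], by
    rintro _ _ ⟨⟩
    refine LinearMap.ext fun f => ?_
    simp
    ring⟩

theorem weylAction_Wp : weylAction K (Wp K) = pOperator K := by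
  simp [weylAction, Wp]

theorem weylAction_Wq : weylAction K (Wq K) = qOperator K := by
  simp [weylAction, Wq]

theorem Wp_bracket_Wq : Wp K * Wq K - Wq K * Wp K = 1 := by
  have := RingQuot.mkAlgHom_rel K (WeylRel.comm (F := K))
  simp only [map_mul, map_add, map_one] at this
  exact sub_eq_iff_eq_add'.2 this

/-- The linear map `X₀ ^ i * X₁ ^ j ↦ q ^ i * p ^ j`. -/
noncomputable def normalOrder : MvPolynomial (Fin 2) K →ₗ[K] WeylAlgebra K :=
  (basisMonomials (Fin 2) K).constr K fun u => Wq K ^ u 0 * Wp K ^ u 1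

theorem normalOrder_monomial (u : Fin 2 →₀ ℕ) (c : K) :
    normalOrder K (monomial u c) = c • (Wq K ^ u 0 * Wp K ^ u 1) := by
  have h : normalOrder K (monomial u 1) = Wq K ^ u 0 * Wp K ^ u 1 :=
    (basisMonomials (Fin 2) K).constr_basis K _ u
  rw [← h, ← map_smul, smul_monomial, smul_eq_mul, mul_one]

theorem normalOrder_C (c : K) : normalOrder K (C c) = algebraMap K _ c := by
  rw [← monomial_zero', normalOrder_monomial]
  simp [Algebra.algebraMap_eq_smul_one]

theorem normalOrder_X_zero_mul (f : MvPolynomial (Fin 2) K) :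
    normalOrder K (X 0 * f) = Wq K * normalOrder K f := by
  induction f using MvPolynomial.induction_on' with
  | monomial u c =>
    rw [mul_comm, X, monomial_mul, normalOrder_monomial, normalOrder_monomial]
    simp [pow_succ', mul_assoc]
  | add f g hf hg => rw [mul_add, map_add, map_add, hf, hg, mul_add]

theorem normalOrder_pOperator (f : MvPolynomial (Fin 2) K) :
    normalOrder K (pOperator K f) = Wp K * normalOrder K f := by
  induction f using MvPolynomial.induction_on' with
  | monomial u c =>
    have h := bracket_pow_of_bracket_eq_one (Wp_bracket_Wq K) (u 0)
    rw [sub_eq_iff_eq_add] at h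
    rw [pOperator_apply, mul_comm, X, monomial_mul, pderiv_monomial, map_add,
      normalOrder_monomial, normalOrder_monomial, normalOrder_monomial]
    rw [mul_smul_comm, ← mul_assoc, h, add_mul, smul_add, add_comm]
    congr 1
    · simp [mul_smul, ← nsmul_eq_mul, Nat.cast_smul_eq_nsmul, smul_mul_assoc]
    · simp [pow_succ', mul_assoc]
  | add f g hf hg => rw [map_add, map_add, map_add, hf, hg, mul_add]

theorem normalOrder_weylAction (a : WeylAlgebra K) (f : MvPolynomial (Fin 2) K) :
    normalOrder K (weylAction K a f) = a * normalOrder K f := by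
  obtain ⟨a, rfl⟩ := RingQuot.mkAlgHom_surjective K (WeylRel K) a
  induction a using FreeAlgebra.induction generalizing f with
  | grade0 r =>
    rw [AlgHom.commutes, AlgHom.commutes, Module.algebraMap_end_apply, map_smul,
      Algebra.smul_def]
  | grade1 i =>
    revert i
    rw [Fin.forall_fin_two]
    constructor
    · change normalOrder K (weylAction K (Wp K) f) = Wp K * normalOrder K f
      rw [weylAction_Wp, normalOrder_pOperator]
    · change normalOrder K (weylAction K (Wq K) f) = Wq K * normalOrder K f
      rw [weylAction_Wq, qOperator_apply, normalOrder_X_zero_mul]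
  | mul a b ha hb => rw [map_mul, map_mul, Module.End.mul_apply, ha, hb, mul_assoc]
  | add a b ha hb => rw [map_add, map_add, LinearMap.add_apply, map_add, ha, hb, add_mul]

/-- The normally ordered symbol of an element of the Weyl algebra. -/
noncomputable def symbol : WeylAlgebra K →ₗ[K] MvPolynomial (Fin 2) K :=
  (LinearMap.applyₗ 1).comp (weylAction K).toLinearMap

variable {K}

theorem symbol_apply (a : WeylAlgebra K) : symbol K a = weylAction K a 1 := rfl

theorem normalOrder_symbol (a : WeylAlgebra K) : normalOrder K (symbol K a) = a := by
  rw [symbol_apply, normalOrder_weylAction, ← C_1, normalOrder_C, map_one, mul_one]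

theorem symbol_one : symbol K 1 = 1 := by simp [symbol_apply]

theorem symbol_eq_zero_iff {a : WeylAlgebra K} : symbol K a = 0 ↔ a = 0 :=
  ⟨fun h => by rw [← normalOrder_symbol a, h, map_zero], fun h => by rw [h, map_zero]⟩

theorem pOperator_pow_apply_sub_mem {g : MvPolynomial (Fin 2) K} {l : ℤ}
    (hg : g ∈ degreeLE K l) (j : ℕ) :
    (pOperator K ^ j) g - (X 1 ^ j * g + pderiv 1 (X 1 ^ j) * pderiv 0 g) ∈
      degreeLE K (j + l - 4) := by
  induction j with
  | zero => simp
  | succ j ih =>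
    set b := (pOperator K ^ j) g - (X 1 ^ j * g + pderiv 1 (X 1 ^ j) * pderiv 0 g) with hb
    have key : (pOperator K ^ (j + 1)) g -
        (X 1 ^ (j + 1) * g + pderiv 1 (X 1 ^ (j + 1)) * pderiv 0 g) =
        X 1 * b + pderiv 0 b + pderiv 1 (X 1 ^ j) * pderiv 0 (pderiv 0 g) := by
      have h1 : pderiv 0 (X 1 : MvPolynomial (Fin 2) K) = 0 := pderiv_X_of_ne (by decide)
      have h2 : pderiv 0 (pderiv 1 (X 1 ^ j : MvPolynomial (Fin 2) K)) = 0 := by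
        rw [pderiv_pow, pderiv_X_self, mul_one, pderiv_mul, pderiv_pow, h1, ← map_natCast C,
          pderiv_C]
        simp
      have h3 : pderiv 0 (X 1 ^ j : MvPolynomial (Fin 2) K) = 0 := by
        rw [pderiv_pow, h1, mul_zero]
      rw [pow_succ' (pOperator K), Module.End.mul_apply, pOperator_apply, hb]
      simp only [pow_succ (X 1 : MvPolynomial (Fin 2) K), pderiv_mul, map_sub, map_add, h2, h3,
        pderiv_X_self]
      ring
    rw [key]
    have hX := X_mem_degreeLE (K := K) 1
    have hXj := pderiv_mem_degreeLE 1 (X_pow_mem_degreeLE (K := K) 1 j)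
    refine add_mem (add_mem ?_ ?_) ?_
    · exact degreeLE_mono (by push_cast; linarith) (mul_mem_degreeLE hX ih)
    · exact degreeLE_mono (by push_cast; linarith) (pderiv_mem_degreeLE 0 ih)
    · exact degreeLE_mono (by push_cast; linarith)
        (mul_mem_degreeLE hXj (pderiv_mem_degreeLE 0 (pderiv_mem_degreeLE 0 hg)))

theorem weylAction_normalOrder_sub_mem {f g : MvPolynomial (Fin 2) K} {k l : ℤ}
    (hf : f ∈ degreeLE K k) (hg : g ∈ degreeLE K l) :
    weylAction K (normalOrder K f) g - (f * g + pderiv 1 f * pderiv 0 g) ∈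
      degreeLE K (k + l - 4) := by
  let B : MvPolynomial (Fin 2) K →ₗ[K] MvPolynomial (Fin 2) K :=
    (LinearMap.applyₗ g).comp ((weylAction K).toLinearMap.comp (normalOrder K)) -
      (LinearMap.mulRight K g + (LinearMap.mulRight K (pderiv 0 g)).comp (pderiv 1).toLinearMap)
  suffices B f ∈ degreeLE K (k + l - 4) from this
  rw [f.as_sum, map_sum]
  refine sum_mem fun u hu => ?_
  have hB : B (monomial u (f.coeff u)) = f.coeff u • (X 0 ^ u 0 *
      ((pOperator K ^ u 1) g -
        (X 1 ^ u 1 * g + pderiv 1 (X 1 ^ u 1) * pderiv 0 g))) := by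
    have hq : ∀ (i : ℕ) (h : MvPolynomial (Fin 2) K), (qOperator K ^ i) h = X 0 ^ i * h := by
      intro i h
      rw [qOperator, LinearMap.pow_mulLeft, LinearMap.mulLeft_apply]
    have hm : monomial u (f.coeff u) = f.coeff u • (X 0 ^ u 0 * X 1 ^ u 1) := by
      rw [monomial_eq, Finsupp.prod_fintype _ _ (by simp), Fin.prod_univ_two, smul_eq_C_mul]
    have hd : pderiv 1 (X 0 ^ u 0 : MvPolynomial (Fin 2) K) = 0 := by
      rw [pderiv_pow, pderiv_X_of_ne (by decide), mul_zero]
    have h1 : weylAction K (normalOrder K (monomial u (f.coeff u))) g =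
        f.coeff u • (X 0 ^ u 0 * (pOperator K ^ u 1) g) := by
      rw [normalOrder_monomial, map_smul, map_mul, map_pow, map_pow, weylAction_Wp,
        weylAction_Wq, LinearMap.smul_apply, Module.End.mul_apply, hq]
    change weylAction K (normalOrder K (monomial u (f.coeff u))) g -
      (monomial u (f.coeff u) * g + pderiv 1 (monomial u (f.coeff u)) * pderiv 0 g) = _
    rw [h1, hm, Derivation.map_smul, pderiv_mul, hd]
    simp only [smul_eq_C_mul]
    ring
  rw [hB]
  refine Submodule.smul_mem _ _ (degreeLE_mono ?_
    (mul_mem_degreeLE (X_pow_mem_degreeLE 0 _) (pOperator_pow_apply_sub_mem hg _)))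
  have := hf u (mem_support_iff.1 hu)
  rw [Finsupp.degree_eq_sum, Fin.sum_univ_two] at this
  push_cast at this
  linarith

theorem symbol_mul_sub_mem (a b : WeylAlgebra K) :
    symbol K (a * b) - (symbol K a * symbol K b + pderiv 1 (symbol K a) * pderiv 0 (symbol K b)) ∈
      degreeLE K ((symbol K a).totalDegree + (symbol K b).totalDegree - 4) := by
  have := weylAction_normalOrder_sub_mem (mem_degreeLE_totalDegree (symbol K a))
    (mem_degreeLE_totalDegree (symbol K b))
  rwa [normalOrder_symbol, symbol_apply b, ← Module.End.mul_apply, ← map_mul, ← symbol_apply,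
    ← symbol_apply] at this

/-- The leading exponent of the symbol for the degree lexicographic order. -/
noncomputable def wdeg (a : WeylAlgebra K) : Fin 2 →₀ ℕ :=
  MonomialOrder.degLex.degree (symbol K a)

/-- The leading coefficient of the symbol for the degree lexicographic order. -/
noncomputable def wlc (a : WeylAlgebra K) : K :=
  MonomialOrder.degLex.leadingCoeff (symbol K a)

section LeadingExponent

variable {a b : WeylAlgebra K}

theorem wdeg_degree (a : WeylAlgebra K) : (wdeg a).degree = (symbol K a).totalDegree :=
  degree_degLexDegree

theorem wlc_ne_zero_iff : wlc a ≠ 0 ↔ a ≠ 0 := by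
  rw [wlc, MonomialOrder.leadingCoeff_ne_zero_iff, Ne, symbol_eq_zero_iff]

theorem degLex_degree_lt_of_totalDegree_lt {f g : MvPolynomial (Fin 2) K}
    (h : f.totalDegree < g.totalDegree) :
    MonomialOrder.degLex.degree f ≺[MonomialOrder.degLex] MonomialOrder.degLex.degree g := by
  rw [MonomialOrder.degLex_lt_iff, Finsupp.DegLex.lt_iff]
  left
  simpa only [ofDegLex_toDegLex, degree_degLexDegree] using h

theorem degLex_lead_add {f r : MvPolynomial (Fin 2) K} {k : ℤ} (hr : r ∈ degreeLE K k)
    (hk : k < f.totalDegree) :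
    MonomialOrder.degLex.degree (f + r) = MonomialOrder.degLex.degree f ∧
      MonomialOrder.degLex.leadingCoeff (f + r) = MonomialOrder.degLex.leadingCoeff f := by
  by_cases h : r = 0
  · simp [h]
  have hlt := degLex_degree_lt_of_totalDegree_lt (f := r) (g := f)
    (by exact_mod_cast (totalDegree_le_of_mem_degreeLE hr h).trans_lt hk)
  exact ⟨MonomialOrder.degree_add_of_lt hlt, MonomialOrder.leadingCoeff_add_of_lt hlt⟩

theorem wdeg_wlc_mul (ha : a ≠ 0) (hb : b ≠ 0) :
    wdeg (a * b) = wdeg a + wdeg b ∧ wlc (a * b) = wlc a * wlc b := by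
  rw [← symbol_eq_zero_iff.ne] at ha hb
  have hr : symbol K (a * b) - symbol K a * symbol K b ∈
      degreeLE K ((symbol K a).totalDegree + (symbol K b).totalDegree - 2) := by
    have h1 := degreeLE_mono (sub_le_sub_left (by norm_num : (2 : ℤ) ≤ 4) _)
      (symbol_mul_sub_mem a b)
    have h2 := mul_mem_degreeLE
      (pderiv_mem_degreeLE 1 (mem_degreeLE_totalDegree (symbol K a)))
      (pderiv_mem_degreeLE 0 (mem_degreeLE_totalDegree (symbol K b)))
    have h3 := add_mem h1 (degreeLE_mono (le_of_eq (by ring)) h2)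
    convert h3 using 1
    ring
  have h := degLex_lead_add (f := symbol K a * symbol K b) hr
    (by rw [totalDegree_mul_of_isDomain ha hb]; push_cast; linarith)
  rwa [add_sub_cancel, MonomialOrder.degree_mul ha hb, MonomialOrder.leadingCoeff_mul] at h

instance : NoZeroDivisors (WeylAlgebra K) where
  eq_zero_or_eq_zero_of_mul_eq_zero {a b} h := by
    by_contra! hab
    have := (wdeg_wlc_mul hab.1 hab.2).2
    rw [h] at this
    refine mul_ne_zero (wlc_ne_zero_iff.2 hab.1) (wlc_ne_zero_iff.2 hab.2) (this.symm.trans ?_)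
    simp [wlc]

instance : Nontrivial (WeylAlgebra K) :=
  ⟨1, 0, symbol_eq_zero_iff.ne.1 (by rw [symbol_one]; exact one_ne_zero)⟩

theorem wdeg_wlc_pow (ha : a ≠ 0) (n : ℕ) :
    wdeg (a ^ n) = n • wdeg a ∧ wlc (a ^ n) = wlc a ^ n := by
  induction n with
  | zero => simp [wdeg, wlc, symbol_one]
  | succ n ih =>
    have h := wdeg_wlc_mul (pow_ne_zero n ha) ha
    rw [← pow_succ, ih.1, ih.2] at h
    rwa [succ_nsmul, pow_succ (wlc a)]

theorem wdeg_neg (a : WeylAlgebra K) : wdeg (-a) = wdeg a := by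
  rw [wdeg, map_neg, MonomialOrder.degree_neg, wdeg]

theorem degree_wdeg_smul_le (c : K) (a : WeylAlgebra K) :
    (wdeg (c • a)).degree ≤ (wdeg a).degree := by
  rw [wdeg_degree, wdeg_degree, map_smul]
  exact totalDegree_smul_le _ _

theorem degree_wdeg_mul_le (a b : WeylAlgebra K) :
    (wdeg (a * b)).degree ≤ (wdeg a).degree + (wdeg b).degree := by
  by_cases ha : a = 0
  · simp [ha, wdeg]
  by_cases hb : b = 0
  · simp [hb, wdeg]
  rw [(wdeg_wlc_mul ha hb).1, map_add]

theorem degree_wdeg_bracket_le (a b : WeylAlgebra K) :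
    (wdeg (a * b - b * a)).degree ≤ (wdeg a).degree + (wdeg b).degree := by
  have h1 := degree_wdeg_mul_le a b
  have h2 := degree_wdeg_mul_le b a
  rw [wdeg_degree] at h1 h2 ⊢
  rw [map_sub]
  exact (totalDegree_sub _ _).trans (max_le h1 (by linarith))

theorem wdeg_sub_of_degree_lt (h : (wdeg b).degree < (wdeg a).degree) :
    wdeg (a - b) = wdeg a := by
  rw [wdeg_degree, wdeg_degree] at h
  rw [wdeg, map_sub, MonomialOrder.degree_sub_of_lt (degLex_degree_lt_of_totalDegree_lt h), wdeg]

theorem wdeg_wlc_add_of_eq (h : wdeg a = wdeg b) (hc : wlc a + wlc b ≠ 0) :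
    wdeg (a + b) = wdeg a ∧ wlc (a + b) = wlc a + wlc b := by
  have hcoeff : (symbol K (a + b)).coeff (wdeg a) = wlc a + wlc b := by
    conv_lhs => rw [map_add, coeff_add]
    nth_rw 2 [h]
    rfl
  have hdeg : wdeg (a + b) = wdeg a := by
    apply MonomialOrder.degLex.toSyn.injective
    apply le_antisymm
    · have := MonomialOrder.degree_add_le (m := MonomialOrder.degLex) (f := symbol K a)
        (g := symbol K b)
      rw [← map_add] at this
      refine this.trans (sup_le le_rfl ?_)
      change _ ≤ MonomialOrder.degLex.toSyn (wdeg a)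
      rw [h]
      rfl
    · refine MonomialOrder.le_degree ?_
      rwa [mem_support_iff, hcoeff]
  refine ⟨hdeg, ?_⟩
  rw [← hcoeff, ← hdeg]
  rfl

theorem exists_smul_wdeg_sub_lt (h : wdeg a = wdeg b) (hb : b ≠ 0) :
    ∃ c : K, a - c • b = 0 ∨ wdeg (a - c • b) ≺[MonomialOrder.degLex] wdeg a := by
  refine ⟨wlc a / wlc b, or_iff_not_imp_left.2 fun h0 => lt_of_le_of_ne ?_ fun heq => ?_⟩
  · have := MonomialOrder.degree_sub_le (m := MonomialOrder.degLex) (f := symbol K a)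
      (g := symbol K ((wlc a / wlc b) • b))
    rw [← map_sub] at this
    refine this.trans (sup_le le_rfl ?_)
    rw [map_smul]
    refine MonomialOrder.degree_smul_le.trans ?_
    rw [h]
    rfl
  · have heq := MonomialOrder.degLex.toSyn.injective heq
    refine wlc_ne_zero_iff.2 h0 ?_
    change coeff (wdeg _) _ = 0
    have h1 : (symbol K a).coeff (wdeg a) = wlc a := rfl
    have h2 : (symbol K b).coeff (wdeg a) = wlc b := by rw [h]; rfl
    rw [heq, map_sub, map_smul, coeff_sub, coeff_smul, h1, h2, smul_eq_mul,
      div_mul_cancel₀ _ (wlc_ne_zero_iff.2 hb), sub_self]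

theorem coeff_X_mul_pderiv (i : Fin 2) (f : MvPolynomial (Fin 2) K) (u : Fin 2 →₀ ℕ) :
    (X i * pderiv i f).coeff u = u i * f.coeff u := by
  induction f using MvPolynomial.induction_on' with
  | monomial v c =>
    rw [X_mul_pderiv_monomial, coeff_smul, coeff_monomial]
    split_ifs with h
    · simp [h]
    · simp
  | add f g hf hg => rw [map_add, mul_add, coeff_add, coeff_add, hf, hg, mul_add]

theorem degLex_degree_X_mul_pderiv_le (i : Fin 2) (f : MvPolynomial (Fin 2) K) :
    MonomialOrder.degLex.degree (X i * pderiv i f) ≼[MonomialOrder.degLex]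
      MonomialOrder.degLex.degree f := by
  refine MonomialOrder.degree_le_degree_of_support_subset fun u hu => ?_
  rw [mem_support_iff, coeff_X_mul_pderiv] at hu
  exact mem_support_iff.2 (right_ne_zero_of_mul hu)

theorem wdeg_mul_eq_of_commute [CharZero K] (ha : a ≠ 0) (hb : b ≠ 0) (h : Commute a b) :
    wdeg a 0 * wdeg b 1 = wdeg a 1 * wdeg b 0 := by
  set f := symbol K a with hf
  set g := symbol K b with hg
  have h1 := sub_mem (symbol_mul_sub_mem b a)
    (degreeLE_mono (le_of_eq (by ring)) (symbol_mul_sub_mem a b))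
  rw [h.eq, ← hf, ← hg] at h1
  have h2 := mul_mem_degreeLE (mul_mem_degreeLE (X_mem_degreeLE 0) (X_mem_degreeLE 1)) h1
  have h3 : (X 1 * pderiv 1 f) * (X 0 * pderiv 0 g) - (X 0 * pderiv 0 f) * (X 1 * pderiv 1 g) ∈
      degreeLE K (1 + 1 + (g.totalDegree + f.totalDegree - 4)) := by
    convert h2 using 1
    ring
  have h4 := mt (h3 (wdeg a + wdeg b)) (by
    rw [map_add, wdeg_degree, wdeg_degree]
    push_cast
    linarith)
  rw [not_not, coeff_sub] at h4
  unfold wdeg at h4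
  rw [← hf, ← hg,
    MonomialOrder.coeff_mul_of_add_of_degree_le (degLex_degree_X_mul_pderiv_le 1 f)
      (degLex_degree_X_mul_pderiv_le 0 g),
    MonomialOrder.coeff_mul_of_add_of_degree_le (degLex_degree_X_mul_pderiv_le 0 f)
      (degLex_degree_X_mul_pderiv_le 1 g)] at h4
  simp only [coeff_X_mul_pderiv] at h4
  change (wdeg a 1 * wlc a) * (wdeg b 0 * wlc b) - (wdeg a 0 * wlc a) * (wdeg b 1 * wlc b) = 0 at h4
  have h5 : ((wdeg a 0 * wdeg b 1 : ℕ) : K) = (wdeg a 1 * wdeg b 0 : ℕ) := by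
    apply mul_right_cancel₀ (mul_ne_zero (wlc_ne_zero_iff.2 ha) (wlc_ne_zero_iff.2 hb))
    push_cast
    linear_combination -h4
  exact_mod_cast h5

theorem degree_smul_wdeg_of_commute [CharZero K] (ha : a ≠ 0) (hb : b ≠ 0) (h : Commute a b) :
    (wdeg a).degree • wdeg b = (wdeg b).degree • wdeg a := by
  have := wdeg_mul_eq_of_commute ha hb h
  rw [Finsupp.degree_eq_sum, Finsupp.degree_eq_sum, Fin.sum_univ_two, Fin.sum_univ_two]
  ext i
  revert i
  rw [Fin.forall_fin_two]
  simp only [Finsupp.smul_apply, smul_eq_mul]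
  constructor <;> linarith

theorem wdeg_wlc_pow_bracket [CharZero K] {c y : WeylAlgebra K} (hc : c ≠ 0)
    (he : c * y - y * c ≠ 0) (k : ℕ) :
    wdeg (c ^ (k + 1) * y - y * c ^ (k + 1)) = k • wdeg c + wdeg (c * y - y * c) ∧
      wlc (c ^ (k + 1) * y - y * c ^ (k + 1)) = (k + 1) * (wlc c ^ k * wlc (c * y - y * c)) := by
  induction k with
  | zero => simp
  | succ k ih =>
    set e := c * y - y * c with hdef
    have hc0 := wlc_ne_zero_iff.2 hc
    have he0 := wlc_ne_zero_iff.2 he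
    set z := c ^ (k + 1) * y - y * c ^ (k + 1) with hz
    have hz0 : z ≠ 0 := by
      rw [← wlc_ne_zero_iff, ih.2]
      exact mul_ne_zero (by exact_mod_cast k.succ_ne_zero) (by positivity)
    have hsum : c ^ (k + 1 + 1) * y - y * c ^ (k + 1 + 1) = c ^ (k + 1) * e + z * c := by
      rw [hz, hdef, pow_succ c (k + 1)]
      simp only [mul_sub, sub_mul, mul_assoc, pow_succ]
      abel
    have h1 := wdeg_wlc_mul (pow_ne_zero (k + 1) hc) he
    rw [(wdeg_wlc_pow hc _).1, (wdeg_wlc_pow hc _).2] at h1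
    have h2 := wdeg_wlc_mul hz0 hc
    rw [ih.1, ih.2] at h2
    have hl : wlc (c ^ (k + 1) * e) + wlc (z * c) =
        ((k + 1 : ℕ) + 1) * (wlc c ^ (k + 1) * wlc e) := by
      rw [h1.2, h2.2]
      push_cast
      ring
    have h3 := wdeg_wlc_add_of_eq (a := c ^ (k + 1) * e) (b := z * c)
      (by rw [h1.1, h2.1, succ_nsmul]; abel)
      (by rw [hl]; exact mul_ne_zero (by exact_mod_cast (k + 1).succ_ne_zero) (by positivity))
    rw [hsum, h3.1, h3.2, hl, h1.1]
    exact ⟨rfl, rfl⟩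

end LeadingExponent

section LocallyNilpotent

variable {x y : WeylAlgebra K}

theorem degree_wdeg_pos_of_notMem_range
    (hx : x ∉ Set.range (algebraMap K (WeylAlgebra K))) : 0 < (wdeg x).degree := by
  refine Nat.pos_of_ne_zero fun h => hx ?_
  rw [wdeg_degree, totalDegree_eq_zero_iff_eq_C] at h
  exact ⟨_, by rw [← normalOrder_C, ← h, normalOrder_symbol]⟩

theorem mem_maxGenEigenspace_zero_iff {V : Type*} [AddCommGroup V] [Module K V]
    {T : Module.End K V} {z : V} : z ∈ T.maxGenEigenspace 0 ↔ ∃ n : ℕ, (T ^ n) z = 0 := by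
  simp only [Module.End.mem_maxGenEigenspace, zero_smul, sub_zero]

/-- The inner derivation `z ↦ x * z - z * x`. -/
noncomputable def bracketEnd (x : WeylAlgebra K) : Module.End K (WeylAlgebra K) :=
  LinearMap.mulLeft K x - LinearMap.mulRight K x

theorem bracketEnd_apply (x z : WeylAlgebra K) : bracketEnd x z = x * z - z * x := rfl

theorem bracketEnd_pow_mul_of_commute {c b : WeylAlgebra K} (hb : Commute x b) (n : ℕ) :
    (bracketEnd x ^ n) (c * b) = (bracketEnd x ^ n) c * b := by
  induction n with
  | zero => rfl
  | succ n ih =>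
    rw [pow_succ', Module.End.mul_apply, Module.End.mul_apply, ih, bracketEnd_apply,
      bracketEnd_apply, sub_mul, mul_assoc, mul_assoc, mul_assoc, hb.eq]

theorem mem_Nset_iff {x z : WeylAlgebra K} :
    z ∈ Nset K x ↔ z ∈ (bracketEnd x).maxGenEigenspace 0 := by
  rw [mem_maxGenEigenspace_zero_iff]
  simp only [Module.End.pow_apply]
  change (∃ n : ℕ, 1 ≤ n ∧ (bracketEnd x)^[n] z = 0) ↔ _
  refine ⟨fun ⟨n, _, h⟩ => ⟨n, h⟩, fun ⟨n, h⟩ => ⟨n + 1, by lia, ?_⟩⟩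
  rw [Function.iterate_succ_apply', h, map_zero]

theorem bracketEnd_pow_mul_pow (hxy : x * y - y * x = 1) {c : WeylAlgebra K}
    (hc : Commute c x) (k : ℕ) : (bracketEnd x ^ k) (c * y ^ k) = k.factorial • c := by
  induction k with
  | zero => simp
  | succ k ih =>
    have h : bracketEnd x (c * y ^ (k + 1)) = (k + 1) • (c * y ^ k) := by
      have h1 := bracket_pow_of_bracket_eq_one hxy (k + 1)
      rw [Nat.add_sub_cancel, ← nsmul_eq_mul] at h1
      rw [← mul_smul_comm, ← h1, bracketEnd_apply, mul_sub, ← mul_assoc, ← hc.eq, mul_assoc,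
        mul_assoc]
    rw [pow_succ, Module.End.mul_apply, h, map_nsmul, ih, ← mul_smul, Nat.factorial_succ]

theorem Dset_eq_Cset_of_Nset_eq_univ (hN : Nset K y = Set.univ) : Dset K y = Cset K y := by
  ext z
  refine ⟨fun ⟨c, hc⟩ => ?_, fun hz => ⟨0, by rw [zero_smul]; exact hz⟩⟩
  obtain ⟨n, -, hn⟩ := (hN ▸ Set.mem_univ z : z ∈ Nset K y)
  have hpow : ∀ n : ℕ, (bracketEnd y ^ n) z = c ^ n • z := by
    intro n
    induction n with
    | zero => simp
    | succ n ih =>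
      rw [pow_succ', Module.End.mul_apply, ih, map_smul, bracketEnd_apply, hc, ← mul_smul,
        pow_succ]
  have h : c ^ n • z = 0 := by
    rw [← hpow, Module.End.pow_apply]
    exact hn
  change y * z - z * y = 0
  rcases smul_eq_zero.1 h with h | h
  · rw [hc, eq_zero_of_pow_eq_zero h, zero_smul]
  · simp [h]

theorem commute_bracket_of_bracket_eq_one (hxy : x * y - y * x = 1) {c : WeylAlgebra K}
    (hc : Commute c x) : Commute (c * y - y * c) x := by
  have h : (c * y - y * c) * x - x * (c * y - y * c) =
      (x * y - y * x) * c - c * (x * y - y * x) + (c * x - x * c) * y - y * (c * x - x * c) := by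
    simp only [sub_mul, mul_sub, mul_assoc]
    abel
  rw [hxy, hc.eq] at h
  exact sub_eq_zero.1 (by simpa using h)

variable [CharZero K]

/-- If the bracket with `y` lowers the degree of `c` by less than the degree of `x`, then some
other element commuting with `x` has its degree lowered by even less. -/
theorem exists_commute_degree_bracket_gt (hxy : x * y - y * x = 1) (hx : 0 < (wdeg x).degree)
    {c : WeylAlgebra K} (hc : Commute c x) (he : c * y - y * c ≠ 0)
    (hlt : (wdeg c).degree < (wdeg (c * y - y * c)).degree + (wdeg x).degree) :
    ∃ w, Commute w x ∧ w * y - y * w ≠ 0 ∧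
      (wdeg w).degree + (wdeg (c * y - y * c)).degree <
        (wdeg (w * y - y * w)).degree + (wdeg c).degree := by
  have hc0 : c ≠ 0 := by rintro rfl; simp at he
  have hx0 : x ≠ 0 := by rintro rfl; simp at hxy
  obtain ⟨n, hn⟩ := Nat.exists_eq_succ_of_ne_zero hx.ne'
  have hprop := degree_smul_wdeg_of_commute hc0 hx0 hc
  set m := (wdeg c).degree with hm
  set e := c * y - y * c with hdef
  rw [hn, Nat.succ_eq_add_one] at hprop hlt
  have hcn := (wdeg_wlc_pow hc0 (n + 1)).1
  have hdeg : wdeg (c ^ (n + 1)) = wdeg (x ^ m) := by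
    rw [hcn, (wdeg_wlc_pow hx0 m).1, hprop]
  obtain ⟨r, hr⟩ := exists_smul_wdeg_sub_lt hdeg (pow_ne_zero m hx0)
  set w := c ^ (n + 1) - r • x ^ m with hw
  have hwx : Commute w x :=
    (hc.pow_left _).sub_left (((Commute.refl x).pow_left m).smul_left r)
  obtain ⟨hA, hAlc⟩ := wdeg_wlc_pow_bracket hc0 he n
  set A := c ^ (n + 1) * y - y * c ^ (n + 1) with hAdef
  have hA0 : A ≠ 0 := by
    rw [← wlc_ne_zero_iff, hAlc]
    have h1 := wlc_ne_zero_iff.2 hc0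
    have h2 := wlc_ne_zero_iff.2 he
    exact mul_ne_zero (by exact_mod_cast n.succ_ne_zero) (mul_ne_zero (pow_ne_zero _ h1) h2)
  have hdw : w * y - y * w = A - (r * m) • x ^ (m - 1) := by
    have h := pow_bracket_of_bracket_eq_one hxy m
    rw [mul_smul, Nat.cast_smul_eq_nsmul, nsmul_eq_mul, ← h, hw, hAdef, smul_sub, sub_mul,
      mul_sub, smul_mul_assoc, mul_smul_comm]
    abel
  have hdA : (wdeg A).degree = n * m + (wdeg e).degree := by
    rw [hA, map_add, map_nsmul, smul_eq_mul]
  obtain ⟨hdw0, hdwA⟩ : w * y - y * w ≠ 0 ∧ wdeg (w * y - y * w) = wdeg A := by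
    rw [hdw]
    rcases Nat.eq_zero_or_pos m with h0 | h0
    · rw [h0]
      simpa using hA0
    · have hB : (wdeg ((r * (m : K)) • x ^ (m - 1))).degree < (wdeg A).degree := by
        refine (degree_wdeg_smul_le _ _).trans_lt ?_
        obtain ⟨k, hk⟩ := Nat.exists_eq_succ_of_ne_zero h0.ne'
        rw [(wdeg_wlc_pow hx0 _).1, map_nsmul, hn, hdA, hk]
        rw [hk] at hlt
        simp only [Nat.succ_eq_add_one, smul_eq_mul, Nat.add_sub_cancel] at hlt ⊢
        nlinarith
      refine ⟨fun h => ?_, wdeg_sub_of_degree_lt hB⟩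
      rw [← sub_eq_zero.1 h] at hB
      exact lt_irrefl _ hB
  have hw0 : w ≠ 0 := fun h => hdw0 (by simp [h])
  have hwlt := hr.resolve_left hw0
  have hle : (wdeg w).degree ≤ (n + 1) * m := by
    have := degLex_totalDegree_monotone hwlt.le
    rwa [← wdeg_degree, ← wdeg_degree, hcn, map_nsmul, smul_eq_mul] at this
  have hne : (wdeg w).degree ≠ (n + 1) * m := by
    intro h
    have h1 := degree_smul_wdeg_of_commute hw0 hx0 hwx
    rw [h, hn, Nat.succ_eq_add_one, mul_smul, hprop, ← hcn] at h1
    refine hwlt.ne (congrArg _ ?_)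
    ext i
    simpa using (DFunLike.congr_fun h1 i).symm
  refine ⟨w, hwx, hdw0, ?_⟩
  rw [hdwA, hdA]
  have := lt_of_le_of_ne hle hne
  linarith

theorem degree_bracket_add_le (hxy : x * y - y * x = 1) (hx : 0 < (wdeg x).degree)
    {c : WeylAlgebra K} (hc : Commute c x) (he : c * y - y * c ≠ 0) :
    (wdeg (c * y - y * c)).degree + (wdeg x).degree ≤ (wdeg c).degree := by
  by_contra! hlt
  obtain ⟨k, hk⟩ : ∃ k, (wdeg c).degree + (wdeg y).degree ≤ (wdeg (c * y - y * c)).degree + k :=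
    ⟨_, Nat.le_add_left _ _⟩
  induction k generalizing c with
  | zero =>
    obtain ⟨w, -, -, hw⟩ := exists_commute_degree_bracket_gt hxy hx hc he hlt
    have := degree_wdeg_bracket_le w y
    linarith
  | succ k ih =>
    obtain ⟨w, hwx, hw0, hw⟩ := exists_commute_degree_bracket_gt hxy hx hc he hlt
    exact ih hwx hw0 (by linarith) (by linarith)

theorem bracket_iterate_eq_zero (hxy : x * y - y * x = 1) (hx : 0 < (wdeg x).degree) (k : ℕ)
    {c : WeylAlgebra K} (hc : Commute c x) (hk : c = 0 ∨ (wdeg c).degree < k) :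
    (fun z => y * z - z * y)^[k] c = 0 := by
  induction k generalizing c with
  | zero => simpa using hk
  | succ k ih =>
    have hneg : y * c - c * y = -(c * y - y * c) := by abel
    rw [Function.iterate_succ_apply]
    refine ih ?_ ?_
    · rw [hneg]
      exact (commute_bracket_of_bracket_eq_one hxy hc).neg_left
    · refine or_iff_not_imp_left.2 fun h0 => ?_
      rw [hneg] at h0 ⊢
      have he := neg_ne_zero.1 h0
      have hc0 : c ≠ 0 := by rintro rfl; simp at he
      rw [wdeg_neg]
      have := degree_bracket_add_le hxy hx hc he
      have := hk.resolve_left hc0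
      lia

theorem Nset_eq_univ_of_bracket_eq_one (hxy : x * y - y * x = 1) (hx : 0 < (wdeg x).degree)
    (hN : Nset K x = Set.univ) : Nset K y = Set.univ := by
  have hC : ∀ (c : WeylAlgebra K) (k : ℕ), Commute c x →
      c * y ^ k ∈ (bracketEnd y).maxGenEigenspace 0 := by
    intro c k hc
    have h : (bracketEnd y ^ ((wdeg c).degree + 1)) c = 0 := by
      rw [Module.End.pow_apply]
      exact bracket_iterate_eq_zero hxy hx _ hc (Or.inr (Nat.lt_succ_self _))
    refine mem_maxGenEigenspace_zero_iff.2 ⟨(wdeg c).degree + 1, ?_⟩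
    rw [bracketEnd_pow_mul_of_commute ((Commute.refl y).pow_right k), h, zero_mul]
  have key : ∀ (n : ℕ) (a : WeylAlgebra K), (bracketEnd x ^ n) a = 0 →
      a ∈ (bracketEnd y).maxGenEigenspace 0 := by
    intro n
    induction n with
    | zero =>
      rintro a rfl
      exact zero_mem _
    | succ k ih =>
      intro a ha
      set c := (bracketEnd x ^ k) a with hc
      have hcx : Commute c x := by
        rw [pow_succ', Module.End.mul_apply, ← hc, bracketEnd_apply, sub_eq_zero] at ha
        exact ha.symm
      have hk : (k.factorial : K) ≠ 0 := by exact_mod_cast k.factorial_ne_zero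
      have h := ih (a - (k.factorial : K)⁻¹ • (c * y ^ k)) (by
        rw [map_sub, map_smul, bracketEnd_pow_mul_pow hxy hcx, ← Nat.cast_smul_eq_nsmul K,
          inv_smul_smul₀ hk, hc, sub_self])
      rw [← sub_add_cancel a ((k.factorial : K)⁻¹ • (c * y ^ k))]
      exact add_mem h (Submodule.smul_mem _ _ (hC c k hcx))
  refine Set.eq_univ_of_forall fun a => mem_Nset_iff.2 ?_
  have ha := mem_Nset_iff.1 (hN ▸ Set.mem_univ a : a ∈ Nset K x)
  obtain ⟨n, hn⟩ := mem_maxGenEigenspace_zero_iff.1 ha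
  exact key n a hn

end LocallyNilpotent

/-- Lemma 3.6. -/
theorem mem_Delta1_of_bracket_eq_one (x y : WeylAlgebra F)
    (hx : x ∈ Delta1 F) (hxy : x * y - y * x = 1) :
    y ∈ Delta1 F := by
  obtain ⟨hxF, hN, -⟩ := hx
  have hNy := Nset_eq_univ_of_bracket_eq_one hxy (degree_wdeg_pos_of_notMem_range hxF) hN
  refine ⟨?_, hNy, Dset_eq_Cset_of_Nset_eq_univ hNy⟩
  rintro ⟨r, rfl⟩
  rw [← Algebra.commutes, sub_self] at hxy
  exact zero_ne_one hxy
end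

section
/- Let x = x_{−n} + ⋯ + x_{−k−1} + x_{−k} with x_i ∈ A_i for each i (that is, all homogeneous components of x of degree greater than −k vanish). If k > 1, then x is unsolvable. (Dual of Lemma 4.1 via the automorphism ω) -/
open scoped BigOperators

variable (F : Type*) [Field F] [CharZero F]

set_option linter.unusedSectionVars false

/-- The action of `p` on sequences indexed by `ℤ`: differentiation. -/
def seqP : Module.End F (ℤ → F) where
  toFun v i := ((i : F) + 1) * v (i + 1)
  map_add' v w := by ext i; simp [mul_add]
  map_smul' c v := by ext i; simp [mul_left_comm]

/-- The action of `q` on sequences indexed by `ℤ`: the shift. -/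
def seqQ : Module.End F (ℤ → F) where
  toFun v i := v (i - 1)
  map_add' v w := by ext i; simp
  map_smul' c v := by ext i; simp

/-- The representation of the Weyl algebra on sequences indexed by `ℤ` (coefficients of two-sided series). -/
noncomputable def seqRep : WeylAlgebra F →ₐ[F] Module.End F (ℤ → F) :=
  RingQuot.liftAlgHom F ⟨FreeAlgebra.lift F ![seqP F, seqQ F], by
    rintro _ _ ⟨⟩
    ext v i
    simp [seqP, seqQ]
    ring⟩

lemma seqRep_Wp : seqRep F (Wp F) = seqP F := by
  simp [seqRep, Wp]

lemma seqRep_Wq : seqRep F (Wq F) = seqQ F := by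
  simp [seqRep, Wq]

open Polynomial in
/-- `D` is the symbol of the operator `T`: `(T v) i = ∑ s, D_s(i) v (i - s)`. -/
def HasSymbol (T : Module.End F (ℤ → F)) (D : ℤ →₀ F[X]) : Prop :=
  ∀ v i, T v i = D.sum fun s P => P.eval (i : F) * v (i - s)

variable {F}

lemma WeylAlgebra.induction {C : WeylAlgebra F → Prop}
    (hc : ∀ c : F, C (algebraMap F _ c)) (hp : C (Wp F)) (hq : C (Wq F))
    (hadd : ∀ a b, C a → C b → C (a + b)) (hmul : ∀ a b, C a → C b → C (a * b))
    (y : WeylAlgebra F) : C y := by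
  obtain ⟨z, rfl⟩ := RingQuot.mkAlgHom_surjective F (WeylRel F) y
  induction z using FreeAlgebra.induction with
  | grade0 c => simpa using hc c
  | grade1 i => fin_cases i <;> assumption
  | mul a b ha hb => simpa using hmul _ _ ha hb
  | add a b ha hb => simpa using hadd _ _ ha hb

open Polynomial in
lemma exists_hasSymbol (y : WeylAlgebra F) : ∃ D : ℤ →₀ F[X], HasSymbol F (seqRep F y) D := by
  induction y using WeylAlgebra.induction with
  | hc c => exact ⟨.single 0 (C c), fun v i => by simp [Algebra.algebraMap_eq_smul_one]⟩
  | hp => exact ⟨.single (-1) (X + 1), fun v i => by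
      rw [Finsupp.sum_single_index (by simp)]; simp [seqRep_Wp, seqP]⟩
  | hq => exact ⟨.single 1 1, fun v i => by simp [seqRep_Wq, seqQ]⟩
  | hadd a b ha hb =>
    obtain ⟨D, hD⟩ := ha
    obtain ⟨E, hE⟩ := hb
    refine ⟨D + E, fun v i => ?_⟩
    rw [Finsupp.sum_add_index' (by simp) (by simp [add_mul])]
    simp [← hD v i, ← hE v i]
  | hmul a b ha hb =>
    obtain ⟨D, hD⟩ := ha
    obtain ⟨E, hE⟩ := hb
    refine ⟨D.sum fun s P => E.sum fun t Q => .single (s + t) (P * Q.comp (X - C (s : F))),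
      fun v i => ?_⟩
    rw [map_mul, Module.End.mul_apply, hD, Finsupp.sum_sum_index (by simp) (by simp [add_mul])]
    refine Finsupp.sum_congr fun s _ => ?_
    rw [hE, Finsupp.sum_sum_index (by simp) (by simp [add_mul]), Finsupp.mul_sum]
    refine Finsupp.sum_congr fun t _ => ?_
    rw [Finsupp.sum_single_index (by simp)]
    simp [mul_assoc, sub_sub]

/-- Sequences supported on `i ≥ 0` are stable. -/
lemma seqRep_apply_eq_zero (y : WeylAlgebra F) :
    ∀ v : ℤ → F, (∀ i < 0, v i = 0) → ∀ i < 0, seqRep F y v i = 0 := by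
  induction y using WeylAlgebra.induction with
  | hc c => intro v hv i hi; simp [Algebra.algebraMap_eq_smul_one, hv i hi]
  | hp =>
    intro v hv i hi
    rcases eq_or_ne i (-1) with rfl | h
    · simp [seqRep_Wp, seqP]
    · simp [seqRep_Wp, seqP, hv (i + 1) (by omega)]
  | hq => intro v hv i hi; simp [seqRep_Wq, seqQ, hv (i - 1) (by omega)]
  | hadd a b ha hb => intro v hv i hi; simp [ha v hv i hi, hb v hv i hi]
  | hmul a b ha hb => intro v hv; simpa using ha _ (hb v hv)

open Polynomial in
lemma HasSymbol.apply_single {T : Module.End F (ℤ → F)} {D : ℤ →₀ F[X]} (h : HasSymbol F T D)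
    (i j : ℤ) : T (Pi.single j 1) i = (D (i - j)).eval (i : F) := by
  rw [h, Finsupp.sum, Finset.sum_eq_single (i - j)]
  · simp
  · intro s _ hs
    rw [Pi.single_eq_of_ne (by omega), mul_zero]
  · simp +contextual

/-- Homogeneous elements act by shifting the index. -/
lemma seqRep_apply_single_of_mem_Wgrade {s : ℤ} {a : WeylAlgebra F} (ha : a ∈ Wgrade F s)
    {i j : ℤ} (h : i - j ≠ s) : seqRep F a (Pi.single j 1) i = 0 := by
  have hH : seqQ F (Pi.single j 1) = Pi.single (j + 1) 1 := by
    ext l; simp [seqQ, Pi.single_apply, sub_eq_iff_eq_add]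
  have hP : seqP F (Pi.single (j + 1) 1) = ((j : F) + 1) • Pi.single j 1 := by
    ext l; by_cases hl : l = j <;> simp [seqP, hl]
  have key := congrFun (LinearMap.congr_fun (congrArg (seqRep F) ha) (Pi.single j 1)) i
  simp only [map_sub, map_mul, seqRep_Wp, seqRep_Wq, LinearMap.sub_apply, Module.End.mul_apply,
    hH, hP, map_smul, map_zsmul, LinearMap.smul_apply, Pi.sub_apply, Pi.smul_apply] at key
  have h1 : seqP F (seqQ F (seqRep F a (Pi.single j 1))) i
      = ((i : F) + 1) * seqRep F a (Pi.single j 1) i := by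
    simp [seqP, seqQ]
  rw [h1, zsmul_eq_mul, smul_eq_mul] at key
  have h2 : ((i - j - s : ℤ) : F) * seqRep F a (Pi.single j 1) i = 0 := by
    push_cast; linear_combination key
  exact (mul_eq_zero.1 h2).resolve_left (by exact_mod_cast sub_ne_zero.2 h)

open Polynomial in
/-- The top symbol of a product, for operators whose symbols vanish in degrees above `a`, `b`. -/
lemma HasSymbol.mul_apply_single {S T : Module.End F (ℤ → F)} {D E : ℤ →₀ F[X]}
    (hS : HasSymbol F S D) (hT : HasSymbol F T E) {a b : ℤ} (hD : ∀ s, a < s → D s = 0)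
    (hE : ∀ s, b < s → E s = 0) (i j : ℤ) (h : a + b ≤ i - j) :
    (S * T) (Pi.single j 1) i =
      if i - j = a + b then (D a).eval (i : F) * (E b).eval ((i - a : ℤ) : F) else 0 := by
  rw [Module.End.mul_apply, hS]
  simp only [hT.apply_single]
  rw [Finsupp.sum, Finset.sum_eq_single a]
  · split_ifs with h'
    · rw [show i - a - j = b by omega]
    · rw [hE _ (by omega)]; simp
  · intro s _ hs
    rcases lt_or_gt_of_ne hs with hs | hs
    · rw [hE _ (by omega)]; simp
    · rw [hD _ hs]; simp
  · simp +contextual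

open Polynomial in
lemma Polynomial.eq_zero_of_eval_progression {P : F[X]} {k : ℤ} (hk : k ≠ 0)
    (h : ∀ n : ℕ, P.eval ((k * n : ℤ) : F) = 0) : P = 0 := by
  refine P.eq_zero_of_infinite_isRoot ((Set.infinite_range_of_injective
    (f := fun n : ℕ => ((k * n : ℤ) : F)) fun m n hmn => ?_).mono ?_)
  · simpa [hk] using hmn
  · rintro _ ⟨n, rfl⟩
    exact h n

open Polynomial in
/-- A polynomial with `P(i + k) = P(i) + 1` is affine, so it cannot vanish at both `0` and `1`. -/
lemma Polynomial.not_forall_eval_add_eq {P : F[X]} {k : ℤ} (hk : k ≠ 0) (h0 : P.eval 0 = 0)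
    (h1 : P.eval 1 = 0)
    (h : ∀ i : ℤ, P.eval ((i + k : ℤ) : F) = P.eval (i : F) + 1) : False := by
  have hP : C (k : F) * P - X = 0 := by
    refine eq_zero_of_eval_progression hk fun n => ?_
    have : P.eval ((k * n : ℤ) : F) = n := by
      induction n with
      | zero => simpa using h0
      | succ n ih =>
        rw [show (k * (n + 1 : ℕ) : ℤ) = k * n + k by push_cast; ring, h, ih]
        simp
    rw [eval_sub, eval_mul, this]
    simp
  simpa [h1] using congrArg (eval 1) hP

open Polynomial in
/-- If `f(i) g(i + k) = g(i) f(i - m)` for nonzero `f`, `g` and `k, m > 0`, then `f` has no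
integer roots. -/
lemma Polynomial.eval_ne_zero_of_mul_shift {f g : F[X]} (hf : f ≠ 0) (hg : g ≠ 0) {k m : ℤ}
    (hk : 0 < k) (hm : 0 < m)
    (h : ∀ i : ℤ, f.eval (i : F) * g.eval ((i + k : ℤ) : F)
      = g.eval (i : F) * f.eval ((i - m : ℤ) : F)) (r : ℤ) : f.eval (r : F) ≠ 0 := by
  intro hr
  have hfin : {t : ℤ | (f * g).eval (t : F) = 0}.Finite :=
    (finite_setOfPred_isRoot (mul_ne_zero hf hg)).preimage Int.cast_injective.injOn
  obtain ⟨t, ht, hmax⟩ := hfin.exists_maximal ⟨r, by simp [hr]⟩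
  have hgt : ∀ j : ℤ, t < j → f.eval (j : F) ≠ 0 ∧ g.eval (j : F) ≠ 0 := fun j hj => by
    have : ¬ (f * g).eval (j : F) = 0 := fun hj0 => absurd (hmax hj0 hj.le) (not_le.2 hj)
    simpa using this
  have hft : f.eval (t : F) ≠ 0 := fun h0 => by
    have := h (t + m)
    rw [add_sub_cancel_right, h0, mul_zero] at this
    exact mul_ne_zero (hgt _ (by omega)).1 (hgt _ (by omega)).2 this
  have hgt0 : g.eval (t : F) = 0 := by simpa [hft] using ht
  have := h t
  rw [hgt0, zero_mul] at this
  exact mul_ne_zero hft (hgt _ (by omega)).2 this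

open Polynomial in
lemma Finsupp.exists_max_degree {D : ℤ →₀ F[X]} (hD : D ≠ 0) :
    ∃ a, D a ≠ 0 ∧ ∀ s, a < s → D s = 0 := by
  obtain ⟨a, ha, hmax⟩ := D.support.exists_maximal (Finsupp.support_nonempty_iff.2 hD)
  refine ⟨a, by simpa using ha, fun s hs => ?_⟩
  by_contra h
  exact absurd (hmax (by simpa using h) hs.le) (not_le.2 hs)

variable (F)


/-- Dual of Lemma 4.1 via the automorphism `ω`. -/
theorem unsolvable_of_components_le_neg_two (k n : ℤ) (hk : 1 < k)
    (xc : ℤ → WeylAlgebra F) (hmem : ∀ i : ℤ, xc i ∈ Wgrade F i)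
    (x : WeylAlgebra F) (hx : x = ∑ i ∈ Finset.Icc (-n) (-k), xc i) :
    ¬ Solvable F x := by
  rintro ⟨y, hxy⟩
  obtain ⟨D, hD⟩ := exists_hasSymbol x
  obtain ⟨E, hE⟩ := exists_hasSymbol y
  have hcomm : seqRep F x * seqRep F y - seqRep F y * seqRep F x = 1 := by
    rw [← map_mul, ← map_mul, ← map_sub, hxy, map_one]
  have hD0 : D ≠ 0 := by
    rintro rfl
    have : seqRep F x = 0 := by ext v i; simp [hD v i]
    simp [this] at hcomm
  have hE0 : E ≠ 0 := by
    rintro rfl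
    have : seqRep F y = 0 := by ext v i; simp [hE v i]
    simp [this] at hcomm
  obtain ⟨a, ha, hDa⟩ := Finsupp.exists_max_degree hD0
  obtain ⟨b, hb, hEb⟩ := Finsupp.exists_max_degree hE0
  have hak : a ≤ -k := by
    by_contra! hlt
    refine ha (Polynomial.eq_zero_of_eval_progression one_ne_zero fun n => ?_)
    have hsymb := hD.apply_single (1 * n) (1 * n - a)
    rw [sub_sub_cancel] at hsymb
    rw [← hsymb, hx, map_sum, LinearMap.sum_apply, Finset.sum_apply]
    refine Finset.sum_eq_zero fun s hs => seqRep_apply_single_of_mem_Wgrade (hmem s) ?_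
    have := (Finset.mem_Icc.1 hs).2
    omega
  have hroot : ∀ i : ℤ, i < 0 → a ≤ i → (D a).eval (i : F) = 0 := fun i hi hai => by
    have := seqRep_apply_eq_zero x (Pi.single (i - a) 1)
      (fun l hl => Pi.single_eq_of_ne (by omega) _) i hi
    rwa [hD.apply_single, sub_sub_cancel] at this
  have hentry : ∀ i j : ℤ, a + b ≤ i - j →
      (if i - j = a + b then (D a).eval (i : F) * (E b).eval ((i - a : ℤ) : F) else 0)
        - (if i - j = b + a then (E b).eval (i : F) * (D a).eval ((i - b : ℤ) : F) else 0)
        = if i = j then 1 else 0 := fun i j hij => by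
    rw [← hD.mul_apply_single hE hDa hEb i j hij,
      ← hE.mul_apply_single hD hEb hDa i j (by omega), ← Pi.sub_apply, ← LinearMap.sub_apply,
      hcomm, Module.End.one_apply, Pi.single_apply]
  have hab : 0 ≤ a + b := by
    by_contra! hlt
    have := hentry 0 0 (by omega)
    rw [if_neg (by omega), if_neg (by omega)] at this
    simp at this
  have htop : ∀ i : ℤ, (D a).eval (i : F) * (E b).eval ((i - a : ℤ) : F)
      - (E b).eval (i : F) * (D a).eval ((i - b : ℤ) : F) = if a + b = 0 then 1 else 0 :=
    fun i => by
      have := hentry i (i - (a + b)) (by omega)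
      rw [if_pos (by omega), if_pos (by omega)] at this
      rw [this]
      exact if_congr (by omega) rfl rfl
  rcases hab.eq_or_lt with h0 | hpos
  · obtain rfl : b = -a := by omega
    refine Polynomial.not_forall_eval_add_eq
      (P := (D a).comp (Polynomial.X + Polynomial.C (a : F)) * E (-a)) (k := -a) (by omega)
      ?_ ?_ fun i => ?_
    · have := hroot a (by omega) le_rfl
      simp [this]
    · have := hroot (1 + a) (by omega) (by omega)
      push_cast at this
      simp [this]
    · have := htop i
      rw [if_pos (by omega)] at this
      push_cast [sub_eq_add_neg] at this ⊢
      simp only [neg_neg] at this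
      simp only [Polynomial.eval_mul, Polynomial.eval_comp, Polynomial.eval_add,
        Polynomial.eval_X, Polynomial.eval_C, neg_add_cancel_right]
      linear_combination this
  · refine Polynomial.eval_ne_zero_of_mul_shift ha hb (k := -a) (m := b) (by omega) (by omega)
      (fun i => ?_) (-1) (hroot (-1) (by omega) (by omega))
    have := htop i
    rw [if_neg (by omega)] at this
    rw [← sub_eq_add_neg]
    exact sub_eq_zero.1 this
end
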